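/- Let c be additive and outcome monotonic, and let π be an outcome monotonic binary policy with π(x_1) = 1 such that for every i > 1 with q_i ≤ γ, either π(x_i) = π(x_{i-1}) − c(x_i,x_{i-1}) or π(x_i) = 0. Then every non-blocking state with positive policy value receives no induced mass: for every i > 1 with π(x_i) ≠ π(x_{i-1}) and π(x_i) > 0, the induced probability P(x_i | π) := Σ_{k : br_π(k) = i} P(x_k) equals 0. -/

import Mathlib

open scoped Classical

/-- The best response of an individual with features `x i` to policy `π` under cost `c`:
the element of `argmax_k (π k - c i k)` with the highest outcome and, among maximizers
with equal outcome, the lowest index.  Since indices are sorted in decreasing order of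
outcome, this is the minimal index among the maximizers. -/
noncomputable def bestResponse {m : ℕ} [NeZero m] (c : Fin m → Fin m → ℝ)
    (π : Fin m → ℝ) (i : Fin m) : Fin m :=
  (Finset.univ.filter (fun k => ∀ l, π l - c i l ≤ π k - c i k)).min' (by
    obtain ⟨k, -, hk⟩ := Finset.exists_max_image Finset.univ (fun k => π k - c i k)
      ⟨i, Finset.mem_univ i⟩
    exact ⟨k, Finset.mem_filter.mpr ⟨Finset.mem_univ k, fun l => hk l (Finset.mem_univ l)⟩⟩)

/-- The utility of a decision policy `π`:  `u(π,γ) = Σ_i P(x_i) · π(x_{br_π(i)}) · (q_{br_π(i)} − γ)`. -/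
noncomputable def utility {m : ℕ} [NeZero m] (P q : Fin m → ℝ) (c : Fin m → Fin m → ℝ)
    (γ : ℝ) (π : Fin m → ℝ) : ℝ :=
  ∑ i, P i * π (bestResponse c π i) * (q (bestResponse c π i) - γ)

/-- A decision policy takes values in `[0,1]`. -/
def IsPolicy {m : ℕ} (π : Fin m → ℝ) : Prop := ∀ i, 0 ≤ π i ∧ π i ≤ 1


theorem bestResponse_isMax {m : ℕ} [NeZero m] (c : Fin m → Fin m → ℝ) (π : Fin m → ℝ)
    (i l : Fin m) : π l - c i l ≤ π (bestResponse c π i) - c i (bestResponse c π i) := by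
  have h : bestResponse c π i ∈
      Finset.univ.filter (fun k => ∀ l, π l - c i l ≤ π k - c i k) := Finset.min'_mem _ _
  exact (Finset.mem_filter.mp h).2 l

theorem bestResponse_le {m : ℕ} [NeZero m] (c : Fin m → Fin m → ℝ) (π : Fin m → ℝ)
    {i k : Fin m} (h : ∀ l, π l - c i l ≤ π k - c i k) : bestResponse c π i ≤ k :=
  Finset.min'_le _ _ (Finset.mem_filter.mpr ⟨Finset.mem_univ k, h⟩)

/-- Under an outcome monotonic binary policy and additive, outcome monotonic costs,
every non-blocking state with positive policy value receives no induced probability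
mass:  if `π i ≠ π j` for the predecessor `j` of `i` and `π i > 0`, then
`P(x_i | π) = Σ_{k : br_π k = i} P k = 0`. -/
theorem stmt5 {m : ℕ} [NeZero m]
    (P q : Fin m → ℝ) (c : Fin m → Fin m → ℝ) (γ : ℝ)
    (hP : ∀ i, 0 ≤ P i) (hPsum : ∑ i, P i = 1)
    (hq : ∀ i, 0 ≤ q i ∧ q i ≤ 1)
    (hsort : ∀ i j : Fin m, i < j → q j ≤ q i)
    (hcdiag : ∀ i, c i i = 0) (hcnonneg : ∀ i j, 0 ≤ c i j)
    (hctri : ∀ i j k, c i k ≤ c i j + c j k)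
    (hcpos : ∀ i j, i ≠ j → q i ≤ q j → 0 < c i j)
    (hγ0 : 0 < γ) (hγ1 : γ < 1)
    (hcm0 : ∀ i j, q j < q i → c i j = 0)
    (hcm1 : ∀ i j k, q i < q j → q j < q k → c i j < c i k)
    (hcm2 : ∀ i j k, q k < q j → q j < q i → c j i < c k i)
    (hcadd : ∀ i j k : Fin m, j ≤ k → k ≤ i → c i j = c i k + c k j)
    (π : Fin m → ℝ) (hπ : IsPolicy π)
    (hmono : ∀ i j, q i < q j ↔ π i < π j)
    (hbin : ∀ i j : Fin m, (j : ℕ) + 1 = (i : ℕ) → γ < q i →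
      (π i = π j ∨ π i = π j - c i j))
    (hπ1 : π 0 = 1)
    (hlow : ∀ i j : Fin m, (j : ℕ) + 1 = (i : ℕ) → q i ≤ γ →
      (π i = π j - c i j ∨ π i = 0)) :
    ∀ i j : Fin m, (j : ℕ) + 1 = (i : ℕ) → π i ≠ π j → 0 < π i →
      ∑ k ∈ Finset.univ.filter (fun k => bestResponse c π k = i), P k = 0 := by
  intro i j hij hne hpos
  have hlt : j < i := Fin.lt_def.mpr (by omega)
  have hstep : π i = π j - c i j := by
    rcases lt_or_ge γ (q i) with h | h
    · exact (hbin i j hij h).resolve_left hne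
    · exact (hlow i j hij h).resolve_right hpos.ne'
  have hqij : q i < q j :=
    (hmono i j).mpr (lt_of_le_of_ne (by linarith [hcnonneg i j]) hne)
  refine Finset.sum_eq_zero fun k hk => ?_
  have hbr : bestResponse c π k = i := (Finset.mem_filter.mp hk).2
  have hmax : ∀ l, π l - c k l ≤ π i - c k i := fun l => by
    simpa only [hbr] using bestResponse_isMax c π k l
  exfalso
  rcases le_or_gt i k with hik | hki
  · have hadd := hcadd k j i hlt.le hik
    have hle := bestResponse_le c π (i := k) (k := j) fun l => by linarith [hmax l]
    exact absurd (hbr ▸ hle) hlt.not_ge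
  · have hqk : q i < q k := by
      rcases (show k ≤ j from Fin.le_def.mpr (by rw [Fin.lt_def] at hki; omega)).eq_or_lt
        with rfl | hkj
      · exact hqij
      · exact hqij.trans_le (hsort k j hkj)
    linarith [hmax k, hcdiag k, hcm0 k i hqk, (hmono i k).mp hqk]
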